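/- Under Assumption (A), let l,m≥1 be integers with (nL+1)T<1 where T=(r+τ)/m, and let K=K(m)≥0 be the constant of Proposition 2.1. Then the approximate predictor map Φ_{l,m}(z,u):=P^{δ_{r+τ}u}_{l,m}z, where (δ_{r+τ}u)(t):=u(t−r−τ), satisfies for every z∈ℝⁿ and every u∈L^∞([−r−τ,0];ℝ): |Φ_{l,m}(z,u)| ≤ Γ·( |z| + sup_{−r−τ≤s<0}|u(s)| ), where Γ := K·((nL+1)T)^{l+1}/(1−(nL+1)T) + exp( ((n+1)L+3)(r+τ)/2 ). (Inequality (2.14)) -/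

import Mathlib

open MeasureTheory Set Matrix

/-- Euclidean norm on `Fin n → ℝ`. -/
noncomputable def vnorm {n : ℕ} (v : Fin n → ℝ) : ℝ := Real.sqrt (∑ i, v i ^ 2)

/-- The vector `c = (1,0,…,0)'`. -/
def cvec (n : ℕ) : Fin n → ℝ := fun i => if (i : ℕ) = 0 then 1 else 0

/-- The vector `b = (0,…,0,1)'`. -/
def bvec (n : ℕ) : Fin n → ℝ := fun i => if (i : ℕ) + 1 = n then 1 else 0

/-- `(AshiftU v a) i = v (i+1)` for `i < n-1`, and `= a` for `i = n-1`:
the superdiagonal shift `A·v` with the last slot replaced by `a`. -/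
def AshiftU {n : ℕ} (v : Fin n → ℝ) (a : ℝ) : Fin n → ℝ :=
  fun i => if h : (i : ℕ) + 1 < n then v ⟨(i : ℕ) + 1, h⟩ else a

/-- Induced (spectral) norm of a matrix. -/
noncomputable def matNorm {n : ℕ} (Q : Matrix (Fin n) (Fin n) ℝ) : ℝ :=
  sSup {c : ℝ | ∃ v : Fin n → ℝ, vnorm v = 1 ∧ c = vnorm (Q.mulVec v)}

/-- The superdiagonal shift matrix `A`. -/
def Amat (n : ℕ) : Matrix (Fin n) (Fin n) ℝ :=
  Matrix.of fun i j => if (i : ℕ) + 1 = (j : ℕ) then 1 else 0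

/-- The constant `ω` of Lemma 2.3. -/
noncomputable def omegaConst (n : ℕ) (L θ : ℝ) (p : Fin n → ℝ) : ℝ :=
  (max (L * ((n : ℝ) + 1) + 2 + 2 * (n : ℝ) *
      (⨆ i : Fin n, θ ^ (2 * ((i : ℕ) + 1)) * (p i) ^ 2)) (1 + L ^ 2)) / 2

/-- The operator `P_{T,u}` of (2.6) (as an operator on functions `ℝ → ℝⁿ`). -/
noncomputable def Pop {n : ℕ} (f : Fin n → (Fin n → ℝ) → ℝ) (u : ℝ → ℝ)
    (x : ℝ → Fin n → ℝ) : ℝ → Fin n → ℝ :=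
  fun t => x 0 + ∫ s in (0:ℝ)..t, ((fun i => f i (x s)) + AshiftU (x s) 0 + u s • bvec n)

/-- The operator `Q^l_{T,u} = C_T ∘ P^l_{T,u} ∘ G_T` of (2.8). -/
noncomputable def Qop {n : ℕ} (f : Fin n → (Fin n → ℝ) → ℝ) (u : ℝ → ℝ) (l : ℕ) (T : ℝ)
    (x₀ : Fin n → ℝ) : Fin n → ℝ :=
  ((Pop f u)^[l] (fun _ => x₀)) T

/-- `PredIter f l T u m = Q^l_{T,u_m} ∘ ⋯ ∘ Q^l_{T,u_1}`, i.e. the map `P^u_{l,m}` of (2.9),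
where `u_i(s) = u(s + (i-1)T)`. -/
noncomputable def PredIter {n : ℕ} (f : Fin n → (Fin n → ℝ) → ℝ) (l : ℕ) (T : ℝ)
    (u : ℝ → ℝ) : ℕ → (Fin n → ℝ) → (Fin n → ℝ)
  | 0 => id
  | (m + 1) => fun x => Qop f (fun s => u (s + (m : ℝ) * T)) l T (PredIter f l T u m x)

open Topology Filter NNReal

lemma exist_aux {n : ℕ} (Φ : (Fin n → ℝ) → (Fin n → ℝ)) (C : ℝ≥0) (hΦ : LipschitzWith C Φ)
    (w : ℝ → Fin n → ℝ) (hw : Continuous w) (S : ℝ) (hS : 0 < S) (x0 : Fin n → ℝ) :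
    ∃ y : ℝ → Fin n → ℝ, y 0 = x0 ∧
      ∀ t ∈ Icc (0:ℝ) S, HasDerivWithinAt y (Φ (y t + w t)) (Icc 0 S) t := by
  obtain ⟨D, hD⟩ := (isCompact_Icc (a := (0:ℝ)) (b := S)).exists_bound_of_continuousOn
    (f := fun t => Φ (w t)) (hΦ.continuous.comp hw).continuousOn
  have hD0 : 0 ≤ D := (norm_nonneg _).trans (hD 0 ⟨le_rfl, hS.le⟩)
  have hgrow : ∀ t ∈ Icc (0:ℝ) S, ∀ p, ‖Φ (p + w t)‖ ≤ C * ‖p‖ + D := by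
    intro t ht p
    have h1 := hΦ.norm_sub_le (p + w t) (w t)
    have h2 := norm_le_norm_sub_add (Φ (p + w t)) (Φ (w t))
    have h3 := hD t ht
    simp only [add_sub_cancel_right] at h1
    linarith
  set R : ℝ := max 0 (gronwallBound ‖x0‖ C D S) with hR
  have hR0 : 0 ≤ R := le_max_left _ _
  let P : (Fin n → ℝ) → (Fin n → ℝ) := fun y i => max (-R) (min R (y i))
  have hPi : ∀ a : ℝ, |max (-R) (min R a)| ≤ |a| ∧ |max (-R) (min R a)| ≤ R ∧
      (|a| ≤ R → max (-R) (min R a) = a) := by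
    intro a
    refine ⟨?_, ?_, ?_⟩
    · rcases max_cases (-R) (min R a) with h | h <;> rcases min_cases R a with h' | h' <;>
        rcases abs_cases a with h'' | h'' <;> rw [abs_le] <;> constructor <;> linarith
    · rw [abs_le]
      exact ⟨le_max_left _ _, max_le (by linarith) (min_le_left _ _)⟩
    · intro h
      rw [abs_le] at h
      rw [min_eq_right h.2, max_eq_right h.1]
  have hP1 : ∀ y, ‖P y‖ ≤ ‖y‖ := fun y => (pi_norm_le_iff_of_nonneg (norm_nonneg _)).2 fun i =>
    (hPi (y i)).1.trans (norm_le_pi_norm y i)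
  have hP2 : ∀ y, ‖P y‖ ≤ R := fun y => (pi_norm_le_iff_of_nonneg hR0).2 fun i => (hPi (y i)).2.1
  have hP3 : ∀ y, ‖y‖ ≤ R → P y = y := fun y hy => funext fun i =>
    (hPi (y i)).2.2 ((norm_le_pi_norm y i).trans hy)
  have hP4 : LipschitzWith 1 P := by
    refine LipschitzWith.of_dist_le_mul fun y z => ?_
    rw [NNReal.coe_one, one_mul, dist_pi_le_iff dist_nonneg]
    intro i
    refine le_trans ?_ (dist_le_pi_dist y z i)
    rw [Real.dist_eq, Real.dist_eq]
    show |max (-R) (min R (y i)) - max (-R) (min R (z i))| ≤ _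
    refine (abs_max_sub_max_le_max _ _ _ _).trans ?_
    refine max_le (by simp) ?_
    refine (abs_min_sub_min_le_max _ _ _ _).trans ?_
    exact max_le (by simp) le_rfl
  let M : ℝ≥0 := ⟨C * R + D, by positivity⟩
  have hpl : IsPicardLindelof (fun t y => Φ (P y + w t)) (tmin := 0) (tmax := S)
      ⟨0, le_rfl, hS.le⟩ x0 (M * ⟨S, hS.le⟩) 0 M C := by
    refine ⟨?_, ?_, ?_, ?_⟩
    · intro t ht
      refine LipschitzWith.lipschitzOnWith ?_
      have : LipschitzWith (C * (1 + 0)) (fun y => Φ (P y + w t)) :=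
        hΦ.comp (hP4.add (LipschitzWith.const (w t)))
      simpa using this
    · intro x _
      exact (hΦ.continuous.comp (continuous_const.add hw)).continuousOn
    · intro t ht x _
      refine (hgrow t ht _).trans ?_
      show _ ≤ C * R + D
      gcongr
      exact hP2 x
    · simp [hS.le]
      exact le_rfl
  obtain ⟨y, hy0, hy⟩ := hpl.exists_eq_forall_mem_Icc_hasDerivWithinAt₀
  refine ⟨y, hy0, fun t ht => ?_⟩
  have hb := norm_le_gronwallBound_of_norm_deriv_right_le (f := y)
    (f' := fun t => Φ (P (y t) + w t)) (δ := ‖x0‖) (K := C) (ε := D) (a := 0) (b := S)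
    (fun t ht => (hy t ht).continuousWithinAt)
    (fun t ht => ((hy t ⟨ht.1, ht.2.le⟩).mono_of_mem_nhdsWithin
      (mem_of_superset (Icc_mem_nhdsGE ht.2) (Icc_subset_Icc_left ht.1))))
    (le_of_eq (congrArg norm hy0))
    (fun t ht => (hgrow t ⟨ht.1, ht.2.le⟩ _).trans (by gcongr; exact hP1 _)) t ht
  have hle : ‖y t‖ ≤ R := by
    refine hb.trans (le_trans ?_ (le_max_right _ _))
    exact gronwallBound_mono (norm_nonneg _) hD0 C.2 (by linarith [ht.2])
  have := hy t ht
  simpa [hP3 _ hle] using this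

lemma vnorm_sq {n : ℕ} (v : Fin n → ℝ) : vnorm v ^ 2 = ∑ i, v i ^ 2 :=
  Real.sq_sqrt (Finset.sum_nonneg fun i _ => sq_nonneg _)

lemma vnorm_nonneg {n : ℕ} (v : Fin n → ℝ) : 0 ≤ vnorm v := Real.sqrt_nonneg _

lemma vnorm_eq {n : ℕ} (v : Fin n → ℝ) : vnorm v = ‖WithLp.toLp 2 v‖ := by
  simp [vnorm, EuclideanSpace.norm_eq]

lemma vnorm_le_sub_add {n : ℕ} (v w : Fin n → ℝ) : vnorm v ≤ vnorm (v - w) + vnorm w := by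
  simp only [vnorm_eq, WithLp.toLp_sub]
  exact norm_le_norm_sub_add _ _

lemma vnorm_le_mul {n : ℕ} (v : Fin n → ℝ) : vnorm v ≤ n * ‖v‖ := by
  unfold vnorm
  apply Real.sqrt_le_iff.2 ⟨by positivity, ?_⟩
  have h1 : ∑ i, v i ^ 2 ≤ ∑ i : Fin n, ‖v‖ ^ 2 := Finset.sum_le_sum fun i _ => by
    have := norm_le_pi_norm v i
    rw [Real.norm_eq_abs] at this
    rw [← sq_abs]
    gcongr
  simp only [Finset.sum_const, Finset.card_univ, Fintype.card_fin, nsmul_eq_mul] at h1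
  refine h1.trans ?_
  rw [mul_pow]
  gcongr
  exact_mod_cast Nat.le_self_pow (by norm_num) n

lemma shift_sq {n : ℕ} (x : Fin n → ℝ) : ∑ i, AshiftU x 0 i ^ 2 ≤ ∑ i, x i ^ 2 := by
  cases n with
  | zero => simp
  | succ k =>
    rw [Fin.sum_univ_castSucc, Fin.sum_univ_succ (fun i => x i ^ 2)]
    have h1 : AshiftU x 0 (Fin.last k) = 0 := by simp [AshiftU]
    have h2 : ∀ i : Fin k, AshiftU x 0 i.castSucc = x i.succ := by
      intro i
      simp [AshiftU, Fin.succ]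
    simp only [h1, h2]
    nlinarith [sq_nonneg (x 0)]

lemma bvec_sq (n : ℕ) : ∑ i, bvec n i ^ 2 ≤ 1 := by
  cases n with
  | zero => simp
  | succ k =>
    rw [Fin.sum_univ_castSucc]
    have h1 : bvec (k+1) (Fin.last k) = 1 := by simp [bvec]
    have h2 : ∀ i : Fin k, bvec (k+1) i.castSucc = 0 := by
      intro i
      have := i.2.ne
      simp [bvec, this]
    simp [h1, h2]

lemma vnorm_trunc {n : ℕ} (x : Fin n → ℝ) (i : Fin n) :
    vnorm (fun j => if (j : ℕ) ≤ (i : ℕ) then x j else 0) ≤ vnorm x := by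
  unfold vnorm
  refine Real.sqrt_le_sqrt (Finset.sum_le_sum fun j _ => ?_)
  dsimp only
  split_ifs
  · exact le_rfl
  · simpa using sq_nonneg (x j)

lemma energy {n : ℕ} {L : ℝ} (hL : 0 ≤ L) (f : Fin n → (Fin n → ℝ) → ℝ)
    (hfLip : ∀ (i : Fin n) (x z : Fin n → ℝ),
      |f i x - f i z| ≤ L * vnorm (fun j => if (j : ℕ) ≤ (i : ℕ) then x j - z j else 0))
    (hf0 : ∀ i, f i (fun _ => 0) = 0) (x : Fin n → ℝ) :
    ∑ i, 2 * x i * (f i x + AshiftU x 0 i) ≤ (((n:ℝ) + 1) * L + 2) * ∑ i, x i ^ 2 := by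
  have h1 : ∀ i, 2 * x i * (f i x + AshiftU x 0 i) ≤
      L * (x i ^ 2 + ∑ j, x j ^ 2) + (x i ^ 2 + AshiftU x 0 i ^ 2) := by
    intro i
    have h := hfLip i x (fun _ => 0)
    rw [hf0] at h
    simp only [sub_zero] at h
    have h2 : |f i x| ≤ L * vnorm x := h.trans (by gcongr; exact vnorm_trunc x i)
    have h3 : x i * f i x ≤ |x i| * (L * vnorm x) := by
      refine (le_abs_self _).trans ?_
      rw [abs_mul]
      gcongr
    have h4 : L * (2 * |x i| * vnorm x) ≤ L * (x i ^ 2 + vnorm x ^ 2) := by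
      gcongr
      rw [← sq_abs (x i)]
      nlinarith [sq_nonneg (|x i| - vnorm x)]
    rw [← vnorm_sq]
    nlinarith [sq_nonneg (x i - AshiftU x 0 i)]
  refine (Finset.sum_le_sum fun i _ => h1 i).trans ?_
  rw [Finset.sum_add_distrib, ← Finset.mul_sum, Finset.sum_add_distrib, Finset.sum_add_distrib]
  simp only [Finset.sum_const, Finset.card_univ, Fintype.card_fin, nsmul_eq_mul]
  nlinarith [shift_sq x]

lemma growth {n : ℕ} {L S U : ℝ} (hL : 0 ≤ L) (hS : 0 < S) (hU : 0 ≤ U)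
    (f : Fin n → (Fin n → ℝ) → ℝ)
    (hfLip : ∀ (i : Fin n) (x z : Fin n → ℝ),
      |f i x - f i z| ≤ L * vnorm (fun j => if (j : ℕ) ≤ (i : ℕ) then x j - z j else 0))
    (hf0 : ∀ i, f i (fun _ => 0) = 0) (x y : ℝ → Fin n → ℝ) (v : ℝ → ℝ)
    (hv : ∀ s t, |v s - v t| ≤ U * |s - t|) (hx : ContinuousOn x (Icc 0 S))
    (hxy : ∀ t i, x t i = y t i + v t * bvec n i)
    (hy : ∀ t ∈ Icc (0:ℝ) S, HasDerivWithinAt y (fun i => f i (x t) + AshiftU (x t) 0 i)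
      (Icc 0 S) t) :
    vnorm (x S) ≤ Real.exp ((((n : ℝ) + 1) * L + 3) / 2 * S) * (vnorm (x 0) + U) := by
  set c : ℝ := ((n : ℝ) + 1) * L + 3 with hc
  have hc3 : 3 ≤ c := by have : 0 ≤ ((n : ℝ) + 1) * L := by positivity
                         linarith
  have hxi : ∀ i, ContinuousOn (fun t => x t i) (Icc 0 S) := continuousOn_pi.1 hx
  have key := le_gronwallBound_of_liminf_deriv_right_le (f := fun t => ∑ i, x t i ^ 2)
    (f' := fun t => ∑ i, (x t i + x t i) * (f i (x t) + AshiftU (x t) 0 i)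
      + |∑ i, (x t i + x t i) * bvec n i| * U)
    (δ := ∑ i, x 0 i ^ 2) (K := c) (ε := U ^ 2) (a := 0) (b := S)
    (continuousOn_finsetSum _ fun i _ => (hxi i).pow 2) ?_ le_rfl ?_ S ⟨hS.le, le_rfl⟩
  · rw [gronwallBound_of_K_ne_0 (by linarith)] at key
    simp only [sub_zero] at key
    have hE : 1 ≤ Real.exp (c * S) := Real.one_le_exp (by positivity)
    have h2 : U ^ 2 / c * (Real.exp (c * S) - 1) ≤ U ^ 2 * Real.exp (c * S) := by
      have : U ^ 2 / c ≤ U ^ 2 := div_le_self (sq_nonneg _) (by linarith)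
      exact mul_le_mul this (by linarith) (by linarith) (sq_nonneg _)
    have hee : Real.exp (c / 2 * S) ^ 2 = Real.exp (c * S) := by
      rw [← Real.exp_nat_mul]; congr 1; push_cast; ring
    refine abs_le_of_sq_le_sq' ?_ (by have := vnorm_nonneg (x 0); positivity) |>.2
    rw [mul_pow, hee, vnorm_sq]
    have h3 := vnorm_sq (x 0)
    have h4 := mul_nonneg (vnorm_nonneg (x 0)) hU
    nlinarith
  · intro t ht r hr
    have hsub : Icc 0 S ∈ 𝓝[>] t :=
      mem_of_superset (Icc_mem_nhdsGT ht.2) (Icc_subset_Icc_left ht.1)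
    have ht' : t ∈ Icc 0 S := ⟨ht.1, ht.2.le⟩
    have hxt : ∀ i, Tendsto (fun z => x z i) (𝓝[>] t) (𝓝 (x t i)) := fun i =>
      ((hxi i) t ht').mono_left (nhdsWithin_le_iff.2 hsub)
    have hyt : ∀ i, Tendsto (fun z => (z - t)⁻¹ * (y z i - y t i)) (𝓝[>] t)
        (𝓝 (f i (x t) + AshiftU (x t) 0 i)) := by
      intro i
      have h1 := (hasDerivWithinAt_pi.1 ((hy t ht').mono_of_mem_nhdsWithin hsub)) i
      have h2 := (hasDerivWithinAt_iff_tendsto_slope' (by simp)).1 h1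
      simpa [slope_fun_def] using h2
    have htend : Tendsto (fun z => ∑ i, (x z i + x t i) * ((z - t)⁻¹ * (y z i - y t i))
        + |∑ i, (x z i + x t i) * bvec n i| * U) (𝓝[>] t)
        (𝓝 (∑ i, (x t i + x t i) * (f i (x t) + AshiftU (x t) 0 i)
          + |∑ i, (x t i + x t i) * bvec n i| * U)) := by
      refine Tendsto.add (tendsto_finsetSum _ fun i _ => ?_) (Tendsto.mul_const _ (Tendsto.abs ?_))
      · exact ((hxt i).add_const _).mul (hyt i)
      · exact tendsto_finsetSum _ fun i _ => ((hxt i).add_const _).mul_const _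
    refine Eventually.frequently ?_
    filter_upwards [htend.eventually_lt_const hr, self_mem_nhdsWithin] with z hz hzt
    refine lt_of_le_of_lt ?_ hz
    have hpos : 0 < z - t := sub_pos.2 hzt
    have hid : (z - t)⁻¹ * (∑ i, x z i ^ 2 - ∑ i, x t i ^ 2) =
        ∑ i, (x z i + x t i) * ((z - t)⁻¹ * (y z i - y t i)) +
        (∑ i, (x z i + x t i) * bvec n i) * ((z - t)⁻¹ * (v z - v t)) := by
      rw [← Finset.sum_sub_distrib, Finset.mul_sum, Finset.sum_mul, ← Finset.sum_add_distrib]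
      refine Finset.sum_congr rfl fun i _ => ?_
      have e1 : y z i = x z i - v z * bvec n i := by rw [hxy]; ring
      have e2 : y t i = x t i - v t * bvec n i := by rw [hxy]; ring
      rw [e1, e2]; ring
    rw [hid]
    refine add_le_add le_rfl ?_
    refine (le_abs_self _).trans ?_
    rw [abs_mul]
    gcongr
    rw [abs_mul, abs_of_pos (inv_pos.2 hpos), inv_mul_le_iff₀ hpos, mul_comm]
    simpa [abs_of_pos hpos] using hv z t
  · intro t _
    have h1 := energy hL f hfLip hf0 (x t)
    have h2 : ∑ i, (x t i + x t i) * (f i (x t) + AshiftU (x t) 0 i) =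
      ∑ i, 2 * x t i * (f i (x t) + AshiftU (x t) 0 i) := by simp only [two_mul]
    have h3 : ∑ i, (x t i + x t i) * bvec n i = 2 * ∑ i, x t i * bvec n i := by
      rw [Finset.mul_sum]; exact Finset.sum_congr rfl fun i _ => by ring
    have h4 := Finset.sum_mul_sq_le_sq_mul_sq Finset.univ (x t) (bvec n)
    have h5 : (∑ i, x t i ^ 2) * ∑ i, bvec n i ^ 2 ≤ ∑ i, x t i ^ 2 :=
      mul_le_of_le_one_right (Finset.sum_nonneg fun i _ => sq_nonneg _) (bvec_sq n)
    rw [h2, h3, abs_mul, abs_two]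
    set B := ∑ i, x t i * bvec n i
    rw [← sq_abs B] at h4
    nlinarith [sq_nonneg (|B| - U)]

lemma field_lip {n : ℕ} {L : ℝ} (hL : 0 ≤ L) (f : Fin n → (Fin n → ℝ) → ℝ)
    (hfLip : ∀ (i : Fin n) (x z : Fin n → ℝ),
      |f i x - f i z| ≤ L * vnorm (fun j => if (j : ℕ) ≤ (i : ℕ) then x j - z j else 0)) :
    ∃ C : ℝ≥0, LipschitzWith C (fun x : Fin n → ℝ => fun i => f i x + AshiftU x 0 i) := by
  refine ⟨⟨L * n + 1, by positivity⟩, LipschitzWith.of_dist_le_mul fun x z => ?_⟩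
  show _ ≤ (L * n + 1) * dist x z
  rw [dist_pi_le_iff (by positivity)]
  intro i
  rw [Real.dist_eq]
  have h1 := hfLip i x z
  have h2 : L * vnorm (fun j => if (j : ℕ) ≤ (i : ℕ) then x j - z j else 0) ≤
      L * (n * dist x z) := by
    gcongr
    refine (vnorm_trunc (x - z) i).trans ?_
    rw [dist_eq_norm]
    exact vnorm_le_mul _
  have h3 : |AshiftU x 0 i - AshiftU z 0 i| ≤ dist x z := by
    unfold AshiftU
    split_ifs with h
    · exact dist_le_pi_dist x z _
    · simp
  have h4 := abs_add_le (f i x - f i z) (AshiftU x 0 i - AshiftU z 0 i)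
  have h5 : f i x + AshiftU x 0 i - (f i z + AshiftU z 0 i) =
    f i x - f i z + (AshiftU x 0 i - AshiftU z 0 i) := by ring
  rw [h5]
  linarith

lemma sol_exists {n : ℕ} {L S : ℝ} (hL : 0 ≤ L) (hS : 0 < S)
    (f : Fin n → (Fin n → ℝ) → ℝ)
    (hfLip : ∀ (i : Fin n) (x z : Fin n → ℝ),
      |f i x - f i z| ≤ L * vnorm (fun j => if (j : ℕ) ≤ (i : ℕ) then x j - z j else 0))
    (hf0 : ∀ i, f i (fun _ => 0) = 0) (z : Fin n → ℝ) (u : ℝ → ℝ) (hu : Measurable u)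
    (U : ℝ) (hU : 0 ≤ U) (hb : ∀ s ∈ Ico 0 S, |u s| ≤ U) :
    ∃ xs : ℝ → Fin n → ℝ, xs 0 = z ∧ ContinuousOn xs (Icc 0 S) ∧
      (∀ t ∈ Icc (0:ℝ) S, ∀ i : Fin n, xs t i = z i + ∫ s in (0:ℝ)..t,
              (f i (xs s) + AshiftU (xs s) 0 i + u s * bvec n i)) ∧
      vnorm (xs S) ≤ Real.exp ((((n : ℝ) + 1) * L + 3) / 2 * S) * (vnorm z + U) := by
  let g : ℝ → ℝ := (Ico 0 S).indicator u
  have hgm : Measurable g := hu.indicator measurableSet_Ico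
  have hgb : ∀ s, ‖g s‖ ≤ U := by
    intro s
    by_cases hs : s ∈ Ico 0 S
    · simpa [g, hs] using hb s hs
    · simpa [g, hs] using hU
  have hgi : ∀ a b, IntervalIntegrable g volume a b := fun a b =>
    (intervalIntegrable_const (c := U)).mono_fun hgm.aestronglyMeasurable
      (Eventually.of_forall fun s => (hgb s).trans (le_abs_self U))
  let v : ℝ → ℝ := fun t => ∫ s in (0:ℝ)..t, g s
  have hv : ∀ s t, |v s - v t| ≤ U * |s - t| := by
    intro s t
    show |(∫ s in (0:ℝ)..s, g s) - ∫ s in (0:ℝ)..t, g s| ≤ _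
    rw [intervalIntegral.integral_interval_sub_left (hgi _ _) (hgi _ _)]
    exact intervalIntegral.norm_integral_le_of_norm_le_const fun x _ => hgb x
  have hvc : Continuous v := by
    refine (LipschitzWith.of_dist_le_mul (K := ⟨U, hU⟩) fun s t => ?_).continuous
    exact hv s t
  obtain ⟨C, hC⟩ := field_lip hL f hfLip
  obtain ⟨y, hy0, hy⟩ := exist_aux _ C hC (fun t => v t • bvec n)
    (hvc.smul continuous_const) S hS z
  have hyc : ContinuousOn y (Icc 0 S) := fun t ht => (hy t ht).continuousWithinAt
  let x : ℝ → Fin n → ℝ := fun t => y t + v t • bvec n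
  have hxc : ContinuousOn x (Icc 0 S) := hyc.add (hvc.smul continuous_const).continuousOn
  have hx0 : x 0 = z := by simp [x, v, hy0]
  refine ⟨x, hx0, hxc, ?_, ?_⟩
  · intro t ht i
    have hΦc : ContinuousOn (fun s => f i (x s) + AshiftU (x s) 0 i) (Icc 0 S) :=
      ((continuous_apply i).comp hC.continuous).comp_continuousOn hxc
    have hint1 : IntervalIntegrable (fun s => f i (x s) + AshiftU (x s) 0 i) volume 0 t := by
      refine ContinuousOn.intervalIntegrable ?_
      rw [uIcc_of_le ht.1]
      exact hΦc.mono (Icc_subset_Icc_right ht.2)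
    have hft : ∫ s in (0:ℝ)..t, (f i (x s) + AshiftU (x s) 0 i) = y t i - y 0 i := by
      refine intervalIntegral.integral_eq_sub_of_hasDerivAt_of_le (f := fun s => y s i) ht.1
        ((continuousOn_pi.1 hyc i).mono (Icc_subset_Icc_right ht.2)) (fun s hs => ?_) hint1
      have hs' : s ∈ Icc 0 S := ⟨hs.1.le, hs.2.le.trans ht.2⟩
      exact hasDerivAt_pi.1 ((hy s hs').hasDerivAt (Icc_mem_nhds hs.1 (hs.2.trans_le ht.2))) i
    have hcongr : ∫ s in (0:ℝ)..t, (f i (x s) + AshiftU (x s) 0 i + u s * bvec n i) =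
        ∫ s in (0:ℝ)..t, (f i (x s) + AshiftU (x s) 0 i + g s * bvec n i) := by
      refine intervalIntegral.integral_congr_ae ?_
      have : ∀ᵐ s ∂(volume : Measure ℝ), s ≠ S := by simp [ae_iff]
      filter_upwards [this] with s hs hst
      rw [uIoc_of_le ht.1] at hst
      have : s ∈ Ico 0 S := ⟨hst.1.le, lt_of_le_of_ne (hst.2.trans ht.2) hs⟩
      simp [g, this]
    rw [hcongr, intervalIntegral.integral_add hint1 ((hgi 0 t).mul_const _), hft,
      intervalIntegral.integral_mul_const, hy0]
    simp only [x, v, Pi.add_apply, Pi.smul_apply, smul_eq_mul]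
    ring
  · have := growth hL hS hU f hfLip hf0 x y v hv hxc (fun t i => rfl) hy
    rwa [hx0] at this

/-- inequality (2.14): growth bound for the approximate predictor map
`Φ_{l,m}(z,u) = P^{δ_{r+τ}u}_{l,m} z`, where `K` is the constant of Proposition 2.1. -/
theorem stmt_5 (n : ℕ) (hn : 0 < n) (L r τ : ℝ) (hL : 0 ≤ L) (hr : 0 ≤ r) (hτ : 0 ≤ τ)
    (hrτ : 0 < r + τ)
    (f : Fin n → (Fin n → ℝ) → ℝ)
    (hfLip : ∀ (i : Fin n) (x z : Fin n → ℝ),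
      |f i x - f i z| ≤ L * vnorm (fun j => if (j : ℕ) ≤ (i : ℕ) then x j - z j else 0))
    (hf0 : ∀ i, f i (fun _ => 0) = 0)
    (l m : ℕ) (hl : 1 ≤ l) (hm : 1 ≤ m)
    (hT : ((n : ℝ) * L + 1) * ((r + τ) / m) < 1)
    (K : ℝ) (hK0 : 0 ≤ K)
    -- K is the constant of Proposition 2.1 (for this m, uniformly in l)
    (hK : ∀ l' : ℕ, 1 ≤ l' →
      ∀ u : ℝ → ℝ, Measurable u → BddAbove ((fun s => |u s|) '' Ico 0 (r + τ)) →
        ∀ (x : Fin n → ℝ) (xs : ℝ → Fin n → ℝ),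
          xs 0 = x →
          ContinuousOn xs (Icc 0 (r + τ)) →
          (∀ t ∈ Icc (0:ℝ) (r + τ), ∀ i : Fin n,
            xs t i = x i + ∫ s in (0:ℝ)..t,
              (f i (xs s) + AshiftU (xs s) 0 i + u s * bvec n i)) →
          vnorm (PredIter f l' ((r + τ) / m) u m x - xs (r + τ)) ≤
            K * (((n : ℝ) * L + 1) * ((r + τ) / m)) ^ (l' + 1) /
                (1 - ((n : ℝ) * L + 1) * ((r + τ) / m)) *
              (vnorm x + sSup ((fun s => |u s|) '' Ico 0 (r + τ))))
    (z : Fin n → ℝ) (u : ℝ → ℝ)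
    (hu_meas : Measurable u)
    (hu_bdd : BddAbove ((fun s => |u s|) '' Ico (-(r + τ)) 0)) :
    vnorm (PredIter f l ((r + τ) / m) (fun s => u (s - (r + τ))) m z) ≤
      (K * (((n : ℝ) * L + 1) * ((r + τ) / m)) ^ (l + 1) /
          (1 - ((n : ℝ) * L + 1) * ((r + τ) / m)) +
        Real.exp ((((n : ℝ) + 1) * L + 3) / 2 * (r + τ))) *
      (vnorm z + sSup ((fun s => |u s|) '' Ico (-(r + τ)) 0)) := by
  set S := r + τ with hSdef
  have himg : (fun s => |u (s - S)|) '' Ico 0 S = (fun s => |u s|) '' Ico (-S) 0 := by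
    ext a
    constructor
    · rintro ⟨s, hs, rfl⟩
      exact ⟨s - S, ⟨by linarith [hs.1], by linarith [hs.2]⟩, rfl⟩
    · rintro ⟨s, hs, rfl⟩
      exact ⟨s + S, ⟨by linarith [hs.1], by linarith [hs.2]⟩, by simp⟩
  set U := sSup ((fun s => |u s|) '' Ico (-S) 0) with hUdef
  have hU0 : 0 ≤ U := Real.sSup_nonneg (by rintro _ ⟨s, _, rfl⟩; exact abs_nonneg _)
  have hub : ∀ s ∈ Ico 0 S, |u (s - S)| ≤ U := by
    intro s hs
    rw [hUdef, ← himg]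
    exact le_csSup (by rw [himg]; exact hu_bdd) ⟨s, hs, rfl⟩
  have hum : Measurable (fun s => u (s - S)) := hu_meas.comp (measurable_id.sub_const S)
  obtain ⟨xs, h0, hc, hi, hg⟩ := sol_exists hL hrτ f hfLip hf0 z _ hum U hU0 hub
  have h := hK l hl (fun s => u (s - S)) hum (by rw [himg]; exact hu_bdd) z xs h0 hc hi
  rw [himg] at h
  have h2 := vnorm_le_sub_add (PredIter f l (S / m) (fun s => u (s - S)) m z) (xs S)
  rw [add_mul]
  linarith
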